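/- arXiv:1803.07753 — 2 statements merged into one kernel-verified Lean document; each statement's English description precedes it below -/
import Mathlib

section
/- (Theorem 3, least squares never recovers the support.) Let X : Ω → ℝ^{d×p} and W : Ω → ℝ^{d×n} be independent random matrices on a probability space, where the entries of W are mutually independent mean-zero Gaussians and the entries in column j of W have variance (Σ_w)_{jj} > 0 for every j, and suppose XᵀX is invertible almost surely. Let Y = XΘ* + W for a fixed Θ* ∈ ℝ^{p×n} and let Θ_ls = (XᵀX)⁻¹XᵀY. If Θ*_{ij} = 0 for some index pair (i,j), then ℙ((Θ_ls)_{ij} = 0) = 0. Consequently, if Θ* has at least one zero entry, then with probability one the set of positions of nonzero entries of Θ_ls differs from that of Θ*. -/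
open MeasureTheory ProbabilityTheory Matrix

lemma aux_indep {Ω α β : Type*} [MeasurableSpace Ω] [MeasurableSpace α] [MeasurableSpace β]
    (μ : Measure Ω) [IsProbabilityMeasure μ] (X : Ω → α) (W : Ω → β)
    (hX : Measurable X) (hW : Measurable W) (h : IndepFun X W μ)
    (S : Set (α × β)) (hS : MeasurableSet S)
    (h0 : ∀ x, μ {ω | (x, W ω) ∈ S} = 0) : μ {ω | (X ω, W ω) ∈ S} = 0 := by
  have h1 := (indepFun_iff_map_prod_eq_prod_map_map hX.aemeasurable hW.aemeasurable).1 h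
  have : IsProbabilityMeasure (μ.map W) := Measure.isProbabilityMeasure_map hW.aemeasurable
  have h2 : μ {ω | (X ω, W ω) ∈ S} = (μ.map (fun ω => (X ω, W ω))) S := by
    rw [Measure.map_apply (hX.prodMk hW) hS]; rfl
  rw [h2, h1, Measure.measure_prod_null hS]
  refine Filter.Eventually.of_forall fun x => ?_
  simp only [Pi.zero_apply]
  rw [Measure.map_apply hW (measurable_prodMk_left hS)]
  exact h0 x

lemma aux_lin {Ω : Type*} [MeasurableSpace Ω] (μ : Measure Ω) [IsProbabilityMeasure μ]
    {d : ℕ} (Z : Fin d → Ω → ℝ) (hZ : ∀ k, Measurable (Z k)) (hi : iIndepFun Z μ)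
    (hat : ∀ k c, μ {ω | Z k ω = c} = 0) (a : Fin d → ℝ) (ha : ∃ k, a k ≠ 0) :
    μ {ω | ∑ k, a k * Z k ω = 0} = 0 := by
  obtain ⟨k, hk⟩ := ha
  have hi2 : iIndepFun (fun l ω => a l * Z l ω) μ :=
    hi.comp (fun l x => a l * x) (fun l => measurable_const.mul measurable_id)
  have hm : ∀ l, Measurable (fun ω => a l * Z l ω) := fun l => (hZ l).const_mul _
  have h3 := hi2.indepFun_finsetSum_of_notMem hm (Finset.notMem_erase k Finset.univ)
  have hs : Measurable (∑ l ∈ Finset.univ.erase k, fun ω => a l * Z l ω) :=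
    by
      have := Finset.measurable_sum (Finset.univ.erase k) (fun l _ => hm l)
      convert this using 1
      ext ω; simp
  have h4 := aux_indep μ _ _ hs (hm k) h3
    {q | q.1 + q.2 = 0} (measurableSet_eq_fun (by fun_prop) (by fun_prop)) (by
      intro x
      refine measure_mono_null (fun ω h => ?_) (hat k (-x / a k))
      change x + a k * Z k ω = 0 at h
      change Z k ω = -x / a k
      rw [eq_div_iff hk]
      linarith)
  refine measure_mono_null (fun ω h => ?_) h4
  change ∑ k, a k * Z k ω = 0 at h
  change (∑ l ∈ Finset.univ.erase k, fun ω => a l * Z l ω) ω + a k * Z k ω = 0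
  rw [Finset.sum_apply, Finset.sum_erase_add _ (fun l => a l * Z l ω) (Finset.mem_univ k)]
  exact h

/-- **Theorem 3.** The least-squares estimator never exactly recovers a zero
entry of the true parameter: if `Θ*_{ij} = 0` then `ℙ((Θ_ls)_{ij} = 0) = 0`; consequently, if
`Θ*` has a zero entry, the support of `Θ_ls` differs from that of `Θ*` almost surely. -/
theorem least_squares_never_recovers_support
    {Ω : Type*} [MeasurableSpace Ω] (μ : Measure Ω) [IsProbabilityMeasure μ]
    (d p n : ℕ)
    (X : Ω → Fin d → Fin p → ℝ) (W : Ω → Fin d → Fin n → ℝ)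
    (hXmeas : Measurable X) (hWmeas : Measurable W)
    (hindep : IndepFun X W μ)
    (σw2 : Fin n → NNReal) (hσw : ∀ j, 0 < σw2 j)
    (hWindep : iIndepFun
      (fun (ij : Fin d × Fin n) (ω : Ω) => W ω ij.1 ij.2) μ)
    (hWgauss : ∀ ij : Fin d × Fin n,
      Measure.map (fun ω => W ω ij.1 ij.2) μ = gaussianReal 0 (σw2 ij.2))
    (hinv : ∀ᵐ ω ∂μ, IsUnit ((Matrix.of (X ω))ᵀ * Matrix.of (X ω)).det)
    (Θstar : Matrix (Fin p) (Fin n) ℝ)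
    (Θls : Ω → Matrix (Fin p) (Fin n) ℝ)
    (hΘls : ∀ ω, Θls ω = ((Matrix.of (X ω))ᵀ * Matrix.of (X ω))⁻¹ * (Matrix.of (X ω))ᵀ *
      (Matrix.of (X ω) * Θstar + Matrix.of (W ω))) :
    (∀ (i : Fin p) (j : Fin n), Θstar i j = 0 → μ {ω | Θls ω i j = 0} = 0) ∧
    ((∃ (i : Fin p) (j : Fin n), Θstar i j = 0) →
      μ {ω | ∀ (i : Fin p) (j : Fin n), Θls ω i j ≠ 0 ↔ Θstar i j ≠ 0} = 0) := by
  have main : ∀ (i : Fin p) (j : Fin n), Θstar i j = 0 → μ {ω | Θls ω i j = 0} = 0 := by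
    intro i j hij
    let M : (Fin d → Fin p → ℝ) → Matrix (Fin p) (Fin p) ℝ := fun x => (Matrix.of x)ᵀ * Matrix.of x
    let G : (Fin d → Fin p → ℝ) → Matrix (Fin p) (Fin d) ℝ :=
      fun x => (M x).adjugate * (Matrix.of x)ᵀ
    have hof : Continuous (fun x : Fin d → Fin p → ℝ => (Matrix.of x : Matrix _ _ ℝ)) :=
      continuous_id
    have hMc : Continuous M := hof.matrix_transpose.matrix_mul hof
    have hGc : Continuous G := hMc.matrix_adjugate.matrix_mul hof.matrix_transpose
    have hGM : ∀ x, G x * Matrix.of x = (M x).det • 1 := fun x => by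
      simp only [G, Matrix.mul_assoc]
      exact Matrix.adjugate_mul (M x)
    let S : Set ((Fin d → Fin p → ℝ) × (Fin d → Fin n → ℝ)) :=
      {q | (M q.1).det ≠ 0 ∧ ∑ k, G q.1 i k * q.2 k j = 0}
    have hS : MeasurableSet S := by
      apply MeasurableSet.inter
      · exact (isOpen_ne_fun (hMc.comp continuous_fst).matrix_det continuous_const).measurableSet
      · refine (isClosed_eq (continuous_finsetSum _ fun k _ => ?_) continuous_const).measurableSet
        exact ((hGc.comp continuous_fst).matrix_elem i k).mul (by fun_prop)
    have hWm : ∀ k l, Measurable (fun ω => W ω k l) := fun k l => by fun_prop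
    have h0 := aux_indep μ X W hXmeas hWmeas hindep S hS (by
      intro x
      by_cases hx : (M x).det = 0
      · simp [S, hx]
      · have := aux_lin μ (fun k ω => W ω k j) (fun k => hWm k j)
          (hWindep.precomp (g := fun k => (k, j)) (fun a b h => (Prod.mk.inj h).1))
          (by
            intro k c
            have hg := hWgauss (k, j)
            have : NullSingletonClass (gaussianReal 0 (σw2 (k, j).2)) :=
              nullSingletonClass_gaussianReal (hσw j).ne'
            have h1 : (μ.map (fun ω => W ω k j)) {c} = 0 := by
              rw [hg]; exact measure_singleton c
            rw [Measure.map_apply (hWm k j) (measurableSet_singleton c)] at h1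
            exact h1) (G x i) (by
              by_contra! hc
              apply hx
              have := congrFun (congrFun (hGM x) i) i
              simpa [Matrix.mul_apply, hc] using this.symm)
        exact measure_mono_null (fun ω h => h.2) this)
    have hne : ∀ᵐ ω ∂μ, ¬ (X ω, W ω) ∈ S := by
      rw [ae_iff]; simpa using h0
    have : ∀ᵐ ω ∂μ, ¬ Θls ω i j = 0 := by
      filter_upwards [hne, hinv] with ω h1 h2 h3
      apply h1
      have h2' : (M (X ω)).det ≠ 0 := h2.ne_zero
      refine ⟨h2', ?_⟩
      have e : (M (X ω)).det • Θls ω = (M (X ω)).det • Θstar + G (X ω) * Matrix.of (W ω) := by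
        have hd : (M (X ω)).det • (M (X ω))⁻¹ = (M (X ω)).adjugate := by
          rw [Matrix.inv_def, smul_smul, Ring.mul_inverse_cancel _ h2, one_smul]
        rw [hΘls]
        change (M (X ω)).det • ((M (X ω))⁻¹ * (Matrix.of (X ω))ᵀ * _) = _
        rw [← Matrix.smul_mul, ← Matrix.smul_mul, hd]
        have hG : (M (X ω)).adjugate * (Matrix.of (X ω))ᵀ = G (X ω) := rfl
        rw [hG, Matrix.mul_add, ← Matrix.mul_assoc, hGM, Matrix.smul_mul, Matrix.one_mul]
      have := congrFun (congrFun e i) j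
      simp [h3, hij, Matrix.mul_apply] at this
      exact this.symm
    rw [ae_iff] at this
    simpa using this
  refine ⟨main, ?_⟩
  rintro ⟨i, j, hij⟩
  refine measure_mono_null (fun ω h => ?_) (main i j hij)
  by_contra hc
  exact (h i j).1 hc hij
end

section
/- (Lemma 8, success of the primal-dual witness construction.) Fix X ∈ ℝ^{d×p}, Y ∈ ℝ^{d×n}, d ≥ 1, λ_d > 0, a partition of the row indices {1,…,p} into row-blocks indexed by {1,…,N}, and a subset A ⊆ {1,…,N}; let I(A) denote the set of rows belonging to the blocks in A and X_A the submatrix of X consisting of the columns indexed by I(A). Assume X_AᵀX_A is invertible. Let Θ̃ ∈ ℝ^{p×n} be the unique minimizer of Θ ↦ (1/(2d))‖Y − XΘ‖_F² + λ_d·‖Θ‖_block over the set of Θ with Θ^{(i)} = 0 for all i ∉ A, and let S̃ ∈ ℝ^{p×n} satisfy (1/d)·Xᵀ(XΘ̃ − Y) + λ_d·S̃ = 0, where the restriction of S̃ to the rows I(A) is a subgradient at the restriction of Θ̃ of the block norm on matrices with rows I(A). If ‖S̃^{(i)}‖₁ < 1 for every block i ∉ A (‖·‖₁ being the entrywise sum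 of absolute values of the block), then Θ̃ is the unique global minimizer of Θ ↦ (1/(2d))‖Y − XΘ‖_F² + λ_d·‖Θ‖_block over all of ℝ^{p×n}. -/
open Matrix
open scoped Classical

/-- `‖Θ^{(i)}‖∞`: the maximum absolute entry of the rows of `Θ` belonging to row-block `i`. -/
noncomputable def rowBlockSup {p n N : ℕ} (rb : Fin p → Fin N)
    (Θ : Matrix (Fin p) (Fin n) ℝ) (i : Fin N) : ℝ :=
  (((Finset.univ.filter fun kl : Fin p × Fin n => rb kl.1 = i).sup
    fun kl => ‖Θ kl.1 kl.2‖₊ : NNReal) : ℝ)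

/-- The row-block norm `‖Θ‖_block = ∑_i ‖Θ^{(i)}‖∞`. -/
noncomputable def rowBlockNorm {p n N : ℕ} (rb : Fin p → Fin N)
    (Θ : Matrix (Fin p) (Fin n) ℝ) : ℝ :=
  ∑ i : Fin N, rowBlockSup rb Θ i

/-- The block-regularized least-squares objective. -/
noncomputable def pdwObj {d p n N : ℕ} (rb : Fin p → Fin N)
    (X : Matrix (Fin d) (Fin p) ℝ) (Y : Matrix (Fin d) (Fin n) ℝ) (lam : ℝ)
    (Θ : Matrix (Fin p) (Fin n) ℝ) : ℝ :=
  (1 / (2 * (d : ℝ))) * (∑ a : Fin d, ∑ b : Fin n, (Y a b - (X * Θ) a b) ^ 2)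
    + lam * rowBlockNorm rb Θ

theorem pdw_aux_le {p n N : ℕ} (rb : Fin p → Fin N) (Θ : Matrix (Fin p) (Fin n) ℝ)
    (k : Fin p) (l : Fin n) : |Θ k l| ≤ rowBlockSup rb Θ (rb k) := by
  unfold rowBlockSup
  have h := Finset.le_sup (f := fun kl : Fin p × Fin n => ‖Θ kl.1 kl.2‖₊)
    (s := Finset.univ.filter fun kl : Fin p × Fin n => rb kl.1 = rb k) (b := (k, l)) (by simp)
  have h2 := NNReal.coe_le_coe.mpr h
  simpa [Real.norm_eq_abs] using h2

theorem pdw_aux_nonneg {p n N : ℕ} (rb : Fin p → Fin N) (Θ : Matrix (Fin p) (Fin n) ℝ)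
    (i : Fin N) : 0 ≤ rowBlockSup rb Θ i := NNReal.coe_nonneg _

theorem pdw_aux_congr {p n N : ℕ} (rb : Fin p → Fin N) (Θ Θ' : Matrix (Fin p) (Fin n) ℝ)
    (i : Fin N) (h : ∀ k, rb k = i → ∀ l, Θ k l = Θ' k l) :
    rowBlockSup rb Θ i = rowBlockSup rb Θ' i := by
  unfold rowBlockSup
  congr 1
  apply Finset.sup_congr rfl
  intro kl hkl
  rw [h kl.1 (by simpa using hkl) kl.2]

theorem pdw_aux_zero {p n N : ℕ} (rb : Fin p → Fin N) (Θ : Matrix (Fin p) (Fin n) ℝ)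
    (i : Fin N) (h : ∀ k, rb k = i → ∀ l, Θ k l = 0) :
    rowBlockSup rb Θ i = 0 := by
  rw [pdw_aux_congr rb Θ 0 i (by simpa using h)]
  unfold rowBlockSup
  simp

theorem pdw_aux_holder {p n N : ℕ} (rb : Fin p → Fin N) (Θ S : Matrix (Fin p) (Fin n) ℝ)
    (i : Fin N) :
    ∑ kl ∈ Finset.univ.filter (fun kl : Fin p × Fin n => rb kl.1 = i), S kl.1 kl.2 * Θ kl.1 kl.2
      ≤ (∑ kl ∈ Finset.univ.filter (fun kl : Fin p × Fin n => rb kl.1 = i), |S kl.1 kl.2|)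
        * rowBlockSup rb Θ i := by
  rw [Finset.sum_mul]
  apply Finset.sum_le_sum
  intro kl hkl
  have hk : rb kl.1 = i := by simpa using hkl
  subst hk
  calc _ ≤ |S kl.1 kl.2 * Θ kl.1 kl.2| := le_abs_self _
    _ = |S kl.1 kl.2| * |Θ kl.1 kl.2| := abs_mul _ _
    _ ≤ _ := mul_le_mul_of_nonneg_left (pdw_aux_le rb Θ _ _) (abs_nonneg _)

theorem pdw_aux_adj {d p n : ℕ} (X : Matrix (Fin d) (Fin p) ℝ) (R : Matrix (Fin d) (Fin n) ℝ)
    (D : Matrix (Fin p) (Fin n) ℝ) :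
    ∑ a, ∑ b, R a b * (X * D) a b = ∑ k, ∑ l, (Xᵀ * R) k l * D k l := by
  have h1 : ∀ {m : ℕ} (P Q : Matrix (Fin m) (Fin n) ℝ),
      ∑ a, ∑ b, P a b * Q a b = (Pᵀ * Q).trace := by
    intro m P Q
    simp only [Matrix.trace, Matrix.diag, Matrix.mul_apply, Matrix.transpose_apply]
    exact Finset.sum_comm
  rw [h1, h1, Matrix.transpose_mul, Matrix.transpose_transpose, Matrix.mul_assoc]

/-- **Lemma 8, success of the primal-dual witness construction.** -/
theorem pdw_success {d p n N : ℕ} (hd : 1 ≤ d)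
    (rb : Fin p → Fin N) (A : Finset (Fin N))
    (X : Matrix (Fin d) (Fin p) ℝ) (Y : Matrix (Fin d) (Fin n) ℝ)
    (lam : ℝ) (hlam : 0 < lam)
    -- `X_AᵀX_A` is invertible
    (hXA : IsUnit ((X.submatrix id (fun a : {x : Fin p // rb x ∈ A} => a.val))ᵀ *
      X.submatrix id (fun a : {x : Fin p // rb x ∈ A} => a.val)).det)
    (Θt : Matrix (Fin p) (Fin n) ℝ)
    -- `Θ̃` is supported on the rows of the blocks of `A` ...
    (hΘtz : ∀ k : Fin p, rb k ∉ A → ∀ l : Fin n, Θt k l = 0)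
    -- ... and is the unique minimizer of the restricted problem
    (hΘtmin : ∀ Θ : Matrix (Fin p) (Fin n) ℝ,
      (∀ k : Fin p, rb k ∉ A → ∀ l : Fin n, Θ k l = 0) → Θ ≠ Θt →
        pdwObj rb X Y lam Θt < pdwObj rb X Y lam Θ)
    (St : Matrix (Fin p) (Fin n) ℝ)
    -- stationarity equation defining the dual variable `S̃`
    (hstat : (1 / (d : ℝ)) • (Xᵀ * (X * Θt - Y)) + lam • St = 0)
    -- the restriction of `S̃` to the rows `I(A)` is a subgradient of the block norm at the
    -- restriction of `Θ̃`
    (hsub : ∀ Θ' : Matrix (Fin p) (Fin n) ℝ,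
      (∀ k : Fin p, rb k ∉ A → ∀ l : Fin n, Θ' k l = 0) →
        rowBlockNorm rb Θt +
            ∑ k : Fin p, ∑ l : Fin n,
              (if rb k ∈ A then St k l * (Θ' k l - Θt k l) else 0) ≤
          rowBlockNorm rb Θ')
    -- strict dual feasibility on the complement of `A`
    (hdualfeas : ∀ i : Fin N, i ∉ A →
      (∑ kl ∈ Finset.univ.filter (fun kl : Fin p × Fin n => rb kl.1 = i),
        |St kl.1 kl.2|) < 1) :
    ∀ Θ : Matrix (Fin p) (Fin n) ℝ, Θ ≠ Θt →
      pdwObj rb X Y lam Θt < pdwObj rb X Y lam Θ := by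
  intro Θ hne
  by_cases hsupp : ∀ k : Fin p, rb k ∉ A → ∀ l : Fin n, Θ k l = 0
  · exact hΘtmin Θ hsupp hne
  push Not at hsupp
  obtain ⟨k₀, hk₀, l₀, hkl₀⟩ := hsupp
  have hd0 : (0 : ℝ) < d := by exact_mod_cast hd
  -- the quadratic part
  have hquad : ∑ a, ∑ b, (Y a b - (X * Θt) a b) ^ 2
      + 2 * ∑ k, ∑ l, (Xᵀ * (X * Θt - Y)) k l * (Θ - Θt) k l
      ≤ ∑ a, ∑ b, (Y a b - (X * Θ) a b) ^ 2 := by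
    rw [← pdw_aux_adj, Finset.mul_sum, ← Finset.sum_add_distrib]
    apply Finset.sum_le_sum
    intro a _
    rw [Finset.mul_sum, ← Finset.sum_add_distrib]
    apply Finset.sum_le_sum
    intro b _
    simp only [Matrix.mul_sub, Matrix.sub_apply]
    nlinarith [sq_nonneg ((X * Θ) a b - (X * Θt) a b)]
  have hG : ∀ k l, (Xᵀ * (X * Θt - Y)) k l = - (d * lam * St k l) := by
    intro k l
    have h := congrFun (congrFun hstat k) l
    simp only [Matrix.add_apply, Matrix.smul_apply, smul_eq_mul, Matrix.zero_apply] at h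
    field_simp at h
    linarith
  have hT : ∑ k, ∑ l, (Xᵀ * (X * Θt - Y)) k l * (Θ - Θt) k l
      = - (d * lam * ∑ k, ∑ l, St k l * (Θ k l - Θt k l)) := by
    simp only [hG, Finset.mul_sum, ← Finset.sum_neg_distrib, Matrix.sub_apply]
    refine Finset.sum_congr rfl fun k _ => Finset.sum_congr rfl fun l _ => by ring
  -- the norm part
  let ΘA : Matrix (Fin p) (Fin n) ℝ := fun k l => if rb k ∈ A then Θ k l else 0
  have hA := hsub ΘA (fun k hk l => by simp [ΘA, hk])
  have hAs : ∑ k : Fin p, ∑ l : Fin n,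
      (if rb k ∈ A then St k l * (ΘA k l - Θt k l) else 0)
      = ∑ k : Fin p, ∑ l : Fin n,
      (if rb k ∈ A then St k l * (Θ k l - Θt k l) else 0) := by
    refine Finset.sum_congr rfl fun k _ => Finset.sum_congr rfl fun l _ => ?_
    by_cases hk : rb k ∈ A <;> simp [ΘA, hk]
  rw [hAs] at hA
  have hsplit : ∑ k, ∑ l, St k l * (Θ k l - Θt k l)
      = ∑ k : Fin p, ∑ l : Fin n, (if rb k ∈ A then St k l * (Θ k l - Θt k l) else 0)
        + ∑ k : Fin p, ∑ l : Fin n, (if rb k ∈ A then 0 else St k l * Θ k l) := by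
    rw [← Finset.sum_add_distrib]
    refine Finset.sum_congr rfl fun k _ => ?_
    rw [← Finset.sum_add_distrib]
    refine Finset.sum_congr rfl fun l _ => ?_
    by_cases hk : rb k ∈ A
    · simp [hk]
    · simp [hk, hΘtz k hk l]
  have hnorm : rowBlockNorm rb Θ = rowBlockNorm rb ΘA
      + ∑ i : Fin N, (if i ∈ A then 0 else rowBlockSup rb Θ i) := by
    unfold rowBlockNorm
    rw [← Finset.sum_add_distrib]
    refine Finset.sum_congr rfl fun i _ => ?_
    by_cases hi : i ∈ A
    · rw [if_pos hi, add_zero]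
      apply pdw_aux_congr
      intro k hk l
      simp [ΘA, hk, hi]
    · rw [if_neg hi, pdw_aux_zero rb ΘA i, zero_add]
      intro k hk l
      simp [ΘA, hk, hi]
  have hfib : ∑ k : Fin p, ∑ l : Fin n, (if rb k ∈ A then 0 else St k l * Θ k l)
      = ∑ i : Fin N, (if i ∈ A then 0 else
        ∑ kl ∈ Finset.univ.filter (fun kl : Fin p × Fin n => rb kl.1 = i),
          St kl.1 kl.2 * Θ kl.1 kl.2) := by
    rw [← Fintype.sum_prod_type' (f := fun (k : Fin p) (l : Fin n) =>
      if rb k ∈ A then 0 else St k l * Θ k l),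
      ← Finset.sum_fiberwise (s := Finset.univ) (g := fun kl : Fin p × Fin n => rb kl.1)]
    refine Finset.sum_congr rfl fun i _ => ?_
    by_cases hi : i ∈ A
    · rw [if_pos hi]
      apply Finset.sum_eq_zero
      intro kl hkl
      have hk : rb kl.1 = i := by simpa using hkl
      simp [hk, hi]
    · rw [if_neg hi]
      refine Finset.sum_congr rfl fun kl hkl => ?_
      have hk : rb kl.1 = i := by simpa using hkl
      simp [hk, hi]
  have hlt : ∑ k : Fin p, ∑ l : Fin n, (if rb k ∈ A then 0 else St k l * Θ k l)
      < ∑ i : Fin N, (if i ∈ A then 0 else rowBlockSup rb Θ i) := by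
    rw [hfib]
    apply Finset.sum_lt_sum
    · intro i _
      by_cases hi : i ∈ A
      · simp [hi]
      · rw [if_neg hi, if_neg hi]
        have h1 := pdw_aux_holder rb Θ St i
        have h2 := hdualfeas i hi
        have h3 := pdw_aux_nonneg rb Θ i
        nlinarith
    · refine ⟨rb k₀, Finset.mem_univ _, ?_⟩
      rw [if_neg hk₀, if_neg hk₀]
      have h1 := pdw_aux_holder rb Θ St (rb k₀)
      have h2 := hdualfeas _ hk₀
      have h3 : 0 < rowBlockSup rb Θ (rb k₀) :=
        lt_of_lt_of_le (abs_pos.mpr hkl₀) (pdw_aux_le rb Θ k₀ l₀)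
      nlinarith
  have hN : rowBlockNorm rb Θt + ∑ k, ∑ l, St k l * (Θ k l - Θt k l) < rowBlockNorm rb Θ := by
    linarith
  rw [hT] at hquad
  have hq := mul_le_mul_of_nonneg_left hquad (by positivity : (0 : ℝ) ≤ 1 / (2 * (d : ℝ)))
  have hn := mul_lt_mul_of_pos_left hN hlam
  unfold pdwObj
  generalize ∑ k, ∑ l, St k l * (Θ k l - Θt k l) = T at *
  have he : 1 / (2 * (d : ℝ)) * (2 * -(d * lam * T)) = - (lam * T) := by
    field_simp
  rw [mul_add, he] at hq
  rw [mul_add] at hn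
  linarith
end
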